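/- Let p be an irreducible and aperiodic stochastic matrix on a countable set S admitting a stationary distribution π. Suppose there exist a nonempty finite subset B ⊆ S, a constant τ ∈ (0,1), and constants C_{ij} > 0 (i,j ∈ S) such that p^{(n),B}_{ij} ≤ C_{ij}·τ^n for all i,j ∈ S and all n ≥ 1. Then the chain converges to the stationary distribution exponentially fast: there exist θ̂ ∈ (0,1) and constants Ĉ_{ij} > 0 such that |p^{(n)}_{ij} − π_j| ≤ Ĉ_{ij}·θ̂^n for all i,j ∈ S and all n ≥ 1. (Proposition 4.4.) -/

import Mathlib

open scoped Classical

/-- Taboo probabilities: `tabooP p B n i j` is the probability of going from `i` to `j`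
in `n` steps while all intermediate states avoid the taboo set `B`. -/
noncomputable def tabooP {S : Type*} (p : S → S → ℝ) (B : Set S) : ℕ → S → S → ℝ
  | 0 => fun i j => if i = j then 1 else 0
  | 1 => fun i j => p i j
  | n + 2 => fun i j => ∑' r : ↥Bᶜ, p i (r : S) * tabooP p B (n + 1) (r : S) j

/-- `n`-step transition probabilities. -/
noncomputable def nstep {S : Type*} (p : S → S → ℝ) : ℕ → S → S → ℝ :=
  tabooP p (∅ : Set S)

open PowerSeries in
/-- Weighted absolute summability: `∑ |a n| * R ^ n < ∞`. -/
def WSummable (R : ℝ) (a : PowerSeries ℝ) : Prop :=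
  Summable fun n => |coeff n a| * R ^ n

section WeightedPowerSeries

open PowerSeries

variable {R : ℝ} {a b : PowerSeries ℝ}

theorem WSummable.add (hR : 0 ≤ R) (ha : WSummable R a) (hb : WSummable R b) :
    WSummable R (a + b) := by
  refine Summable.of_nonneg_of_le (fun n => by positivity) (fun n => ?_) (Summable.add ha hb)
  rw [map_add, ← add_mul]
  gcongr
  exact abs_add_le _ _

theorem WSummable.norm_smul (ha : WSummable R a) {z : ℂ} (hz : ‖z‖ = R) :
    Summable fun n => ‖((coeff n a : ℝ) : ℂ) * z ^ n‖ := by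
  simpa [WSummable, hz] using ha

theorem WSummable.norm_coeff_mul (hR : 0 ≤ R) (ha : WSummable R a) :
    Summable fun n => ‖coeff n a * R ^ n‖ := by
  simpa [WSummable, abs_of_nonneg hR] using ha

theorem sum_antidiagonal_coeff_mul_pow {𝕜 : Type*} [RCLike 𝕜] (a b : PowerSeries ℝ) (z : 𝕜)
    (n : ℕ) :
    ∑ kl ∈ Finset.HasAntidiagonal.antidiagonal n,
      (((coeff kl.1 a : ℝ) : 𝕜) * z ^ kl.1) * (((coeff kl.2 b : ℝ) : 𝕜) * z ^ kl.2) =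
      ((coeff n (a * b) : ℝ) : 𝕜) * z ^ n := by
  rw [coeff_mul]
  push_cast
  rw [Finset.sum_mul]
  refine Finset.sum_congr rfl fun kl hkl => ?_
  rw [← Finset.HasAntidiagonal.mem_antidiagonal.1 hkl, pow_add]
  ring

theorem WSummable.mul (hR : 0 ≤ R) (ha : WSummable R a) (hb : WSummable R b) :
    WSummable R (a * b) := by
  have h := summable_norm_sum_mul_antidiagonal_of_summable_norm
    (ha.norm_coeff_mul hR) (hb.norm_coeff_mul hR)
  have e := sum_antidiagonal_coeff_mul_pow (𝕜 := ℝ) a b R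
  simp only [RCLike.ofReal_real_eq_id, id_eq] at e
  simpa [e, WSummable, abs_of_nonneg hR] using h

theorem WSummable.mono (ha : WSummable R a) {r : ℝ} (hr : 0 ≤ r) (h : r ≤ R) :
    WSummable r a :=
  Summable.of_nonneg_of_le (fun n => by positivity) (fun n => by gcongr) ha

theorem wSummable_of_coeff_eq_zero {N : ℕ} (h : ∀ n, N ≤ n → coeff n a = 0) : WSummable R a :=
  summable_of_ne_finset_zero (s := Finset.range N) fun n hn => by
    simp [h n (by simpa using hn)]

theorem wSummable_one : WSummable R (1 : PowerSeries ℝ) :=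
  wSummable_of_coeff_eq_zero (N := 1) fun n hn => by simp [coeff_one]; lia

theorem wSummable_one_sub_X : WSummable R (1 - X : PowerSeries ℝ) :=
  wSummable_of_coeff_eq_zero (N := 2) fun n hn => by
    simp [coeff_one, coeff_X]; grind

/-- Evaluation of a real power series at a complex number. -/
noncomputable def cEval (a : PowerSeries ℝ) (z : ℂ) : ℂ := ∑' n, ((coeff n a : ℝ) : ℂ) * z ^ n

theorem WSummable.hasSum_cEval (ha : WSummable R a) {z : ℂ} (hz : ‖z‖ = R) :
    HasSum (fun n => ((coeff n a : ℝ) : ℂ) * z ^ n) (cEval a z) :=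
  (ha.norm_smul hz).of_norm.hasSum

theorem WSummable.cEval_mul (ha : WSummable R a) (hb : WSummable R b) {z : ℂ} (hz : ‖z‖ = R) :
    cEval (a * b) z = cEval a z * cEval b z := by
  rw [cEval, cEval, cEval, tsum_mul_tsum_eq_tsum_sum_antidiagonal_of_summable_norm
    (ha.norm_smul hz) (hb.norm_smul hz)]
  exact tsum_congr fun n => (sum_antidiagonal_coeff_mul_pow (𝕜 := ℂ) a b z n).symm

theorem cEval_one (z : ℂ) : cEval 1 z = 1 := by
  rw [cEval, tsum_eq_single 0]
  · simp
  · intro n hn; simp [coeff_one, hn]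

theorem WSummable.cEval_one_sub (ha : WSummable R a) {z : ℂ} (hz : ‖z‖ = R) :
    cEval (1 - a) z = 1 - cEval a z := by
  have h := ((wSummable_one (R := R)).hasSum_cEval hz).sub (ha.hasSum_cEval hz)
  rw [cEval_one] at h
  rw [← h.tsum_eq, cEval]
  exact tsum_congr fun n => by push_cast [map_sub]; ring

theorem cEval_X (z : ℂ) : cEval X z = z := by
  rw [cEval, tsum_eq_single 1]
  · simp
  · intro n hn; simp [coeff_X, hn]

theorem WSummable.tsum_coeff_mul (ha : WSummable 1 a) (hb : WSummable 1 b) :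
    ∑' n, coeff n (a * b) = (∑' n, coeff n a) * ∑' n, coeff n b := by
  have h := fun n => sum_antidiagonal_coeff_mul_pow (𝕜 := ℝ) a b 1 n
  simp only [RCLike.ofReal_real_eq_id, id_eq, one_pow, mul_one] at h
  rw [tsum_mul_tsum_eq_tsum_sum_antidiagonal_of_summable_norm]
  · exact tsum_congr fun n => (h n).symm
  · simpa [WSummable] using ha
  · simpa [WSummable] using hb

/-- A nonnegative power series of total mass less than one has a geometrically summable
inverse of `1 - f`. -/
theorem exists_wSummable_inverse_of_tsum_lt_one (hR : 1 < R) {f u : PowerSeries ℝ}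
    (hf : ∀ n, 0 ≤ coeff n f) (hu : ∀ n, 0 ≤ coeff n u) (hfR : WSummable R f)
    (hlt : ∑' n, coeff n f < 1) (hfu : u = 1 + f * u) :
    ∃ r, 1 < r ∧ r ≤ R ∧ WSummable r u := by
  have hcont : ContinuousOn (fun x : ℝ => ∑' n, coeff n f * x ^ n) (Set.Icc 0 R) := by
    refine continuousOn_tsum (fun n => by fun_prop) hfR fun n x hx => ?_
    rw [norm_mul, norm_pow, Real.norm_eq_abs, Real.norm_eq_abs, abs_of_nonneg hx.1]
    gcongr
    exacts [hx.1, hx.2]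
  have hev := (hcont.continuousAt (Icc_mem_nhds one_pos hR)).eventually_lt
    (continuousAt_const (y := (1 : ℝ))) (by simpa using hlt)
  obtain ⟨r, ⟨hr1, hrR⟩, hr⟩ : ∃ r, r ∈ Set.Ioo 1 R ∧ ∑' n, coeff n f * r ^ n < 1 := by
    have h1 : ∀ᶠ r in nhdsWithin (1 : ℝ) (Set.Ioi 1), r ∈ Set.Ioo 1 R := Ioo_mem_nhdsGT hR
    exact (h1.and (hev.filter_mono nhdsWithin_le_nhds)).exists
  have hr0 : 0 ≤ r := by linarith
  set q := ∑' n, coeff n f * r ^ n with hq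
  have hfr : Summable fun n => coeff n f * r ^ n := by
    simpa [WSummable, abs_of_nonneg (hf _)] using hfR.mono hr0 hrR.le
  refine ⟨r, hr1, hrR.le, ?_⟩
  have key : ∀ N, ∑ n ∈ Finset.range N, coeff n u * r ^ n ≤ 1 / (1 - q) := by
    intro N
    set s := ∑ n ∈ Finset.range N, coeff n u * r ^ n with hs
    have hs_nonneg : 0 ≤ s := Finset.sum_nonneg fun n _ => mul_nonneg (hu n) (by positivity)
    have h1 : s ≤ 1 + q * s := by
      have hconv : ∑ n ∈ Finset.range N, coeff n (f * u) * r ^ n ≤ q * s := by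
        have e := sum_antidiagonal_coeff_mul_pow (𝕜 := ℝ) f u r
        simp only [RCLike.ofReal_real_eq_id, id_eq] at e
        simp_rw [← e]
        calc _ ≤ (∑ k ∈ Finset.range N, coeff k f * r ^ k) * s := by
              rw [hs, Finset.sum_mul_sum, ← Finset.sum_product', ← Finset.sum_biUnion]
              · refine Finset.sum_le_sum_of_subset_of_nonneg ?_ fun x _ _ =>
                  mul_nonneg (mul_nonneg (hf _) (by positivity)) (mul_nonneg (hu _) (by positivity))
                intro x hx
                simp only [Finset.mem_biUnion, Finset.mem_range, Finset.HasAntidiagonal.mem_antidiagonal,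
                  Finset.mem_product] at hx ⊢
                lia
              · intro m _ n _ hmn
                refine Finset.disjoint_left.2 fun x hx hx' => hmn ?_
                rw [← Finset.HasAntidiagonal.mem_antidiagonal.1 hx, Finset.HasAntidiagonal.mem_antidiagonal.1 hx']
          _ ≤ q * s := by
              gcongr
              exact hfr.sum_le_tsum _ fun n _ => mul_nonneg (hf n) (by positivity)
      calc s = ∑ n ∈ Finset.range N, (coeff n (1 : PowerSeries ℝ) * r ^ n
              + coeff n (f * u) * r ^ n) := by
            rw [hs]
            refine Finset.sum_congr rfl fun n _ => ?_
            rw [← add_mul, ← map_add, ← hfu]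
        _ ≤ 1 + q * s := by
            rw [Finset.sum_add_distrib]
            gcongr
            simp only [coeff_one, ite_mul, one_mul, zero_mul, Finset.sum_ite_eq']
            split_ifs <;> simp
    rw [le_div_iff₀ (by linarith)]
    linarith
  refine summable_of_sum_range_le (c := 1 / (1 - q)) (fun n => by positivity) fun N => ?_
  simpa only [abs_of_nonneg (hu _)] using key N

end WeightedPowerSeries

section Renewal

open PowerSeries

variable {R : ℝ} {f u : PowerSeries ℝ}

theorem cEval_at_one (hsum : HasSum (fun n => coeff n f) 1) : cEval f 1 = 1 := by
  simp only [cEval, one_pow, mul_one]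
  exact_mod_cast hsum.tsum_eq

/-- A probability distribution on the positive integers whose support generates `ℤ` has a
generating function that takes the value one on the closed unit disc only at one. -/
theorem eq_one_of_cEval_eq_one (hf : ∀ n, 0 ≤ coeff n f)
    (hsum : HasSum (fun n => coeff n f) 1)
    (hgcd : ∀ d : ℕ, (∀ n, 0 < coeff n f → d ∣ n) → d = 1)
    {z : ℂ} (hz : ‖z‖ ≤ 1) (h : cEval f z = 1) : z = 1 := by
  have hs : Summable fun n => ((coeff n f : ℝ) : ℂ) * z ^ n := by
    refine Summable.of_norm_bounded hsum.summable fun n => ?_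
    rw [norm_mul, norm_pow, Complex.norm_real, Real.norm_of_nonneg (hf n)]
    exact mul_le_of_le_one_right (hf n) (pow_le_one₀ (norm_nonneg z) hz)
  have hre : HasSum (fun n => coeff n f * (z ^ n).re) 1 := by
    have h2 := Complex.hasSum_re (hs.hasSum_iff.2 h)
    simpa [Complex.re_ofReal_mul] using h2
  have hdiff : HasSum (fun n => coeff n f * (1 - (z ^ n).re)) 0 := by
    simpa [mul_sub] using hsum.sub hre
  have hnorm : ∀ n, ‖z ^ n‖ ≤ 1 := fun n => by
    rw [norm_pow]; exact pow_le_one₀ (norm_nonneg z) hz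
  have hre1 : ∀ n, (z ^ n).re ≤ 1 := fun n => (Complex.re_le_norm _).trans (hnorm n)
  have hzero := (hasSum_zero_iff_of_nonneg
    (fun n => mul_nonneg (hf n) (sub_nonneg.2 (hre1 n)))).1 hdiff
  have hpow : ∀ n, 0 < coeff n f → z ^ n = 1 := by
    intro n hn
    have h1 : (z ^ n).re = 1 := by
      have := congrFun hzero n
      simp only [Pi.zero_apply, mul_eq_zero, hn.ne', false_or] at this
      linarith
    have h2 : (z ^ n).im = 0 := by
      have h3 : ‖z ^ n‖ ^ 2 ≤ 1 := pow_le_one₀ (norm_nonneg _) (hnorm n)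
      rw [Complex.sq_norm, Complex.normSq_apply, h1] at h3
      nlinarith
    exact Complex.ext h1 h2
  have := hgcd (orderOf z) fun n hn => orderOf_dvd_of_pow_eq_one (hpow n hn)
  rwa [orderOf_eq_one_iff] at this

theorem differentiableOn_cEval (hf : WSummable R f) :
    DifferentiableOn ℂ (cEval f) (Metric.ball 0 R) := by
  refine Complex.differentiableOn_tsum_of_summable_norm hf
    (fun n => by fun_prop) Metric.isOpen_ball fun n z hz => ?_
  rw [norm_mul, norm_pow, Complex.norm_real, Real.norm_eq_abs]
  have : ‖z‖ ≤ R := (mem_ball_zero_iff.1 hz).le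
  gcongr

theorem one_le_norm_dslope_cEval_one (hR : 1 < R) (hfR : WSummable R f)
    (hf : ∀ n, 0 ≤ coeff n f) (hf0 : coeff 0 f = 0) (hsum : HasSum (fun n => coeff n f) 1) :
    1 ≤ ‖dslope (cEval f) 1 1‖ := by
  have h1R : (1 : ℂ) ∈ Metric.ball (0 : ℂ) R := by simpa using hR
  have hnhds : Metric.ball (0 : ℂ) R ∈ nhds 1 := Metric.isOpen_ball.mem_nhds h1R
  have hcont : ContinuousAt (dslope (cEval f) 1) 1 :=
    (((Complex.differentiableOn_dslope hnhds).2
      (differentiableOn_cEval hfR)).differentiableAt hnhds).continuousAt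
  have hlim : Filter.Tendsto (fun x : ℝ => ‖dslope (cEval f) 1 (x : ℂ)‖)
      (nhdsWithin 1 (Set.Iio 1)) (nhds ‖dslope (cEval f) 1 1‖) := by
    have h2 : ContinuousAt (fun x : ℝ => ‖dslope (cEval f) 1 (x : ℂ)‖) 1 := by
      refine ContinuousAt.norm (ContinuousAt.comp (g := dslope (cEval f) 1) ?_
        Complex.continuous_ofReal.continuousAt)
      simpa using hcont
    simpa using h2.tendsto.mono_left nhdsWithin_le_nhds
  refine ge_of_tendsto hlim ?_
  filter_upwards [Ioo_mem_nhdsLT (zero_lt_one (α := ℝ))] with x hx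
  have hx1 : (x : ℂ) ≠ 1 := by exact_mod_cast hx.2.ne
  have hnx : ‖(x : ℂ)‖ = x := by rw [Complex.norm_real, Real.norm_of_nonneg hx.1.le]
  have hev : cEval f x = ((∑' n, coeff n f * x ^ n : ℝ) : ℂ) := by
    rw [cEval]; push_cast; rfl
  have hev1 : cEval f 1 = 1 := cEval_at_one hsum
  have hsx : Summable fun n => coeff n f * x ^ n := by
    simpa [WSummable, abs_of_nonneg (hf _)] using hfR.mono hx.1.le (by linarith [hx.2])
  have hle : ∑' n, coeff n f * x ^ n ≤ x := by
    calc _ ≤ ∑' n, coeff n f * x := by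
          refine hsx.tsum_le_tsum (fun n => ?_) (hsum.summable.mul_right x)
          rcases Nat.eq_zero_or_pos n with rfl | hn
          · simp [hf0]
          · exact mul_le_mul_of_nonneg_left
              (pow_le_of_le_one hx.1.le hx.2.le hn.ne') (hf n)
      _ = x := by rw [(hsum.mul_right x).tsum_eq, one_mul]
  rw [dslope_of_ne _ hx1, slope_def_field, hev, hev1, norm_div]
  have e1 : (((∑' n, coeff n f * x ^ n : ℝ) : ℂ) - 1) =
      (((∑' n, coeff n f * x ^ n) - 1 : ℝ) : ℂ) := by push_cast; rfl
  have e2 : ((x : ℂ) - 1) = ((x - 1 : ℝ) : ℂ) := by push_cast; rfl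
  rw [e1, e2, Complex.norm_real, Complex.norm_real, Real.norm_eq_abs, Real.norm_eq_abs,
    abs_of_nonpos (by linarith [hx.2]), abs_of_neg (by linarith [hx.2]),
    one_le_div (by linarith [hx.2])]
  linarith

/-- **Renewal theorem with exponential rate**: if the aperiodic renewal distribution `f` has
geometrically decaying tails, then so do the increments of the renewal sequence `u`. -/
theorem exists_wSummable_one_sub_X_mul_renewal (hR : 1 < R) (hfR : WSummable R f)
    (hf : ∀ n, 0 ≤ coeff n f) (hf0 : coeff 0 f = 0) (hsum : HasSum (fun n => coeff n f) 1)
    (hgcd : ∀ d : ℕ, (∀ n, 0 < coeff n f → d ∣ n) → d = 1)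
    (hu : ∀ n, |coeff n u| ≤ 1) (hfu : u = 1 + f * u) :
    ∃ r, 1 < r ∧ r ≤ R ∧ WSummable r ((1 - X) * u) := by
  set G := dslope (cEval f) 1 with hG
  have h1R : (1 : ℂ) ∈ Metric.ball (0 : ℂ) R := by simpa using hR
  have hnhds : Metric.ball (0 : ℂ) R ∈ nhds 1 := Metric.isOpen_ball.mem_nhds h1R
  have hGdiff : DifferentiableOn ℂ G (Metric.ball 0 R) :=
    (Complex.differentiableOn_dslope hnhds).2 (differentiableOn_cEval hfR)
  have hev1 : cEval f 1 = 1 := cEval_at_one hsum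
  have hGne : ∀ z : ℂ, z ≠ 1 → G z * (1 - z) = 1 - cEval f z := by
    intro z hz
    have : z - 1 ≠ 0 := sub_ne_zero.2 hz
    rw [hG, dslope_of_ne _ hz, slope_def_field, hev1]
    field_simp
    ring
  have hG0 : ∀ z ∈ Metric.closedBall (0 : ℂ) 1, G z ≠ 0 := by
    intro z hz h0
    by_cases hz1 : z = 1
    · have := one_le_norm_dslope_cEval_one hR hfR hf hf0 hsum
      rw [← hG, ← hz1, h0] at this
      norm_num at this
    · have h2 := hGne z hz1
      rw [h0, zero_mul] at h2
      exact hz1 (eq_one_of_cEval_eq_one hf hsum hgcd (by simpa using hz)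
        (sub_eq_zero.1 h2.symm).symm)
  have hopen : IsOpen (Metric.ball (0 : ℂ) R ∩ G ⁻¹' {0}ᶜ) :=
    hGdiff.continuousOn.isOpen_inter_preimage Metric.isOpen_ball isOpen_compl_singleton
  obtain ⟨δ, hδ, hsub⟩ := (isCompact_closedBall (0 : ℂ) 1).exists_cthickening_subset_open hopen
    fun z hz => ⟨Metric.closedBall_subset_ball hR hz, hG0 z hz⟩
  rw [cthickening_closedBall hδ.le zero_le_one] at hsub
  have hδR : δ + 1 < R := by
    have : ((δ + 1 : ℝ) : ℂ) ∈ Metric.closedBall (0 : ℂ) (δ + 1) := by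
      rw [mem_closedBall_zero_iff, Complex.norm_real, Real.norm_of_nonneg (by linarith)]
    have := (hsub this).1
    rwa [mem_ball_zero_iff, Complex.norm_real, Real.norm_of_nonneg (by linarith)] at this
  lift δ + 1 to NNReal using by linarith with ρ hρ
  have hinv : DifferentiableOn ℂ (fun z => (G z)⁻¹) (Metric.closedBall 0 (ρ : ℝ)) :=
    (hGdiff.mono fun z hz => (hsub hz).1).inv fun z hz => (hsub hz).2
  have hρ0 : 0 < ρ := by
    have : (0 : ℝ) < ρ := by linarith
    exact_mod_cast this
  have hps := hinv.hasFPowerSeriesOnBall hρ0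
  set v := (1 - X) * u with hv
  have huW : ∀ r : ℝ, 0 ≤ r → r < 1 → WSummable r u := fun r hr0 hr1 =>
    Summable.of_nonneg_of_le (fun n => by positivity)
      (fun n => mul_le_of_le_one_left (by positivity) (hu n)) (summable_geometric_of_lt_one hr0 hr1)
  have hvps : HasFPowerSeriesAt (fun z => (G z)⁻¹)
      (FormalMultilinearSeries.ofScalars ℂ fun n => ((coeff n v : ℝ) : ℂ)) 0 := by
    rw [hasFPowerSeriesAt_iff]
    filter_upwards [Metric.ball_mem_nhds (0 : ℂ) one_pos] with z hz
    rw [mem_ball_zero_iff] at hz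
    have hu' := huW ‖z‖ (norm_nonneg z) hz
    have hv' : WSummable ‖z‖ v := wSummable_one_sub_X.mul (norm_nonneg z) hu'
    have hf' : WSummable ‖z‖ f := hfR.mono (norm_nonneg z) (by linarith)
    have h1f : WSummable ‖z‖ (1 - f) := by
      simpa [WSummable, sub_eq_add_neg] using wSummable_one.add (norm_nonneg z)
        (show WSummable ‖z‖ (-f) by simpa [WSummable] using hf')
    have hmul : v * (1 - f) = 1 - X := by
      rw [hv]; linear_combination (1 - X) * hfu
    have h3 := hv'.cEval_mul h1f rfl
    rw [hmul, hf'.cEval_one_sub rfl, WSummable.cEval_one_sub (R := ‖z‖) ?_ rfl, cEval_X] at h3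
    · have hz1 : z ≠ 1 := by rintro rfl; simp at hz
      have hGz : G z ≠ 0 := hG0 z (by simpa using hz.le)
      rw [← hGne z hz1] at h3
      have h4 : (G z)⁻¹ = cEval v z := by
        have : (1 - z) ≠ 0 := sub_ne_zero.2 hz1.symm
        field_simp
        refine mul_right_cancel₀ this ?_
        linear_combination h3
      rw [zero_add, h4]
      simpa [FormalMultilinearSeries.coeff_ofScalars, mul_comm] using hv'.hasSum_cEval rfl
    · exact wSummable_of_coeff_eq_zero (N := 2) fun n hn => by
        rw [coeff_X, if_neg (by lia)]
  have heq := hvps.eq_formalMultilinearSeries hps.hasFPowerSeriesAt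
  obtain ⟨r, hr1, hrρ⟩ := exists_between (show (1 : NNReal) < ρ by
    have : (1 : ℝ) < ρ := by linarith
    exact_mod_cast this)
  refine ⟨r, by exact_mod_cast hr1, ?_, ?_⟩
  · have : (r : ℝ) < ρ := by exact_mod_cast hrρ
    linarith
  · have hs := FormalMultilinearSeries.summable_norm_mul_pow _
      ((ENNReal.coe_lt_coe.2 hrρ).trans_le hps.r_le)
    rw [← heq] at hs
    simpa [WSummable, FormalMultilinearSeries.norm_apply_eq_norm_coef,
      FormalMultilinearSeries.coeff_ofScalars] using hs

end Renewal

section Taboo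

open PowerSeries

variable {S : Type*} {p : S → S → ℝ} {B : Set S}

theorem tabooP_add_two (p : S → S → ℝ) (B : Set S) (n : ℕ) (i j : S) :
    tabooP p B (n + 2) i j = ∑' r, Bᶜ.indicator (fun r => p i r * tabooP p B (n + 1) r j) r := by
  rw [← tsum_subtype]
  rfl

theorem tabooP_nonneg (hp : ∀ i j, 0 ≤ p i j) (B : Set S) : ∀ n i j, 0 ≤ tabooP p B n i j
  | 0, i, j => by simp only [tabooP]; split_ifs <;> simp
  | 1, i, j => hp i j
  | n + 2, i, j => tsum_nonneg fun r => mul_nonneg (hp _ _) (tabooP_nonneg hp B (n + 1) _ _)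

theorem summable_mul_of_bounded {i : S} (hp : ∀ i j, 0 ≤ p i j)
    (hrow : ∀ i, HasSum (fun j => p i j) 1) {g : S → ℝ} (hg0 : ∀ r, 0 ≤ g r) {K : ℝ}
    (hgK : ∀ r, g r ≤ K) : Summable fun r => p i r * g r :=
  Summable.of_nonneg_of_le (fun r => mul_nonneg (hp _ _) (hg0 r))
    (fun r => mul_le_mul_of_nonneg_left (hgK r) (hp _ _)) ((hrow i).summable.mul_right K)

theorem tabooP_le_one (hp : ∀ i j, 0 ≤ p i j) (hrow : ∀ i, HasSum (fun j => p i j) 1)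
    (B : Set S) : ∀ n i j, tabooP p B n i j ≤ 1
  | 0, i, j => by simp only [tabooP]; split_ifs <;> simp
  | 1, i, j => by
      rw [← (hrow i).tsum_eq]
      exact (hrow i).summable.le_tsum j fun k _ => hp i k
  | n + 2, i, j => by
      have hs := summable_mul_of_bounded (i := i) hp hrow
        (fun r => tabooP_nonneg hp B (n + 1) r j) (fun r => tabooP_le_one hp hrow B (n + 1) r j)
      rw [tabooP_add_two, ← (hrow i).tsum_eq]
      refine (hs.indicator _).tsum_le_tsum (fun r => ?_) (hrow i).summable
      refine (Set.indicator_le_self' (fun r _ =>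
        mul_nonneg (hp _ _) (tabooP_nonneg hp B (n + 1) r j)) r).trans ?_
      exact mul_le_of_le_one_right (hp _ _) (tabooP_le_one hp hrow B (n + 1) r j)

theorem summable_indicator_mul_tabooP (hp : ∀ i j, 0 ≤ p i j)
    (hrow : ∀ i, HasSum (fun j => p i j) 1) (A B : Set S) (n : ℕ) (i j : S) :
    Summable (A.indicator fun r => p i r * tabooP p B n r j) :=
  (summable_mul_of_bounded hp hrow (fun r => tabooP_nonneg hp B n r j)
    (fun r => tabooP_le_one hp hrow B n r j)).indicator A

/-- First passage decomposition at a state `c`. -/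
theorem tabooP_eq_add_sum_insert (hp : ∀ i j, 0 ≤ p i j)
    (hrow : ∀ i, HasSum (fun j => p i j) 1) {A : Set S} {c : S} (hc : c ∉ A) (j : S) (n : ℕ) :
    ∀ i, tabooP p A (n + 1) i j = tabooP p (insert c A) (n + 1) i j +
      ∑ k ∈ Finset.range n, tabooP p (insert c A) (k + 1) i c * tabooP p A (n - k) c j := by
  induction n with
  | zero => intro i; simp [tabooP]
  | succ n ih =>
    intro i
    have hs := fun k => summable_indicator_mul_tabooP hp hrow (insert c A)ᶜ (insert c A) (k + 1) i
    have hsplit : ∀ r, Aᶜ.indicator (fun r => p i r * tabooP p A (n + 1) r j) r =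
        (if r = c then p i c * tabooP p A (n + 1) c j else 0) +
        ((insert c A)ᶜ.indicator (fun r => p i r * tabooP p (insert c A) (n + 1) r j) r +
        ∑ k ∈ Finset.range n, (insert c A)ᶜ.indicator
          (fun r => p i r * tabooP p (insert c A) (k + 1) r c) r * tabooP p A (n - k) c j) := by
      intro r
      by_cases hrc : r = c
      · subst hrc
        simp [hc]
      · by_cases hrA : r ∈ A
        · simp [hrA, hrc]
        · simp only [Set.indicator, Set.mem_compl_iff, Set.mem_insert_iff, hrc, hrA, or_self,
            not_false_eq_true, if_true, if_false, ih r, zero_add]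
          rw [mul_add, Finset.mul_sum]
          simp only [mul_assoc]
    rw [tabooP_add_two, tabooP_add_two, tsum_congr hsplit,
      Summable.tsum_add (hasSum_ite_eq c _).summable ((hs n j).add
        (summable_sum fun k _ => (hs k c).mul_right _)), tsum_ite_eq,
      Summable.tsum_add (hs n j) (summable_sum fun k _ => (hs k c).mul_right _),
      Summable.tsum_finsetSum fun k _ => (hs k c).mul_right _, Finset.sum_range_succ']
    simp only [tsum_mul_right, ← tabooP_add_two, Nat.sub_zero, Nat.add_sub_add_right]
    simp only [tabooP]
    ring

/-- The generating function of the taboo probabilities, without the zero-step term. -/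
noncomputable def tabooGF (p : S → S → ℝ) (B : Set S) (i j : S) : PowerSeries ℝ :=
  PowerSeries.mk fun n => if n = 0 then 0 else tabooP p B n i j

@[simp]
theorem coeff_zero_tabooGF (i j : S) : coeff 0 (tabooGF p B i j) = 0 := by
  simp [tabooGF, coeff_mk]

theorem coeff_tabooGF {n : ℕ} (hn : n ≠ 0) (i j : S) :
    coeff n (tabooGF p B i j) = tabooP p B n i j := by
  simp [tabooGF, coeff_mk, hn]

theorem coeff_tabooGF_nonneg (hp : ∀ i j, 0 ≤ p i j) (n : ℕ) (i j : S) :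
    0 ≤ coeff n (tabooGF p B i j) := by
  rw [tabooGF, coeff_mk]
  split_ifs
  exacts [le_rfl, tabooP_nonneg hp B n i j]

theorem tabooGF_eq_add_mul (hp : ∀ i j, 0 ≤ p i j)
    (hrow : ∀ i, HasSum (fun j => p i j) 1) {A : Set S} {c : S} (hc : c ∉ A) (i j : S) :
    tabooGF p A i j = tabooGF p (insert c A) i j +
      tabooGF p (insert c A) i c * tabooGF p A c j := by
  ext n
  rw [map_add, coeff_mul]
  cases n with
  | zero => simp
  | succ n =>
    rw [coeff_tabooGF n.succ_ne_zero, coeff_tabooGF n.succ_ne_zero,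
      tabooP_eq_add_sum_insert hp hrow hc, Finset.Nat.sum_antidiagonal_eq_sum_range_succ_mk,
      Finset.sum_range_succ', Finset.sum_range_succ]
    simp only [Nat.sub_self, coeff_zero_tabooGF, mul_zero, zero_mul, add_zero, Nat.reduceSubDiff]
    congr 1
    refine Finset.sum_congr rfl fun k hk => ?_
    have := Finset.mem_range.1 hk
    rw [coeff_tabooGF (by lia), coeff_tabooGF (by lia)]

/-- The first visit to `B` hits at most one point of `D ⊆ B`. -/
theorem sum_tabooP_le_one (hp : ∀ i j, 0 ≤ p i j)
    (hrow : ∀ i, HasSum (fun j => p i j) 1) {D : Finset S} (hD : ↑D ⊆ B) (n : ℕ) :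
    ∀ i, ∑ k ∈ Finset.range n, ∑ d ∈ D, tabooP p B (k + 1) i d ≤ 1 := by
  induction n with
  | zero => simp
  | succ n ih =>
    intro i
    have hs := fun k d => summable_indicator_mul_tabooP hp hrow Bᶜ B (k + 1) i d
    have hpD : Summable fun r => if r ∈ D then p i r else 0 :=
      summable_of_ne_finset_zero (s := D) fun r hr => by simp [hr]
    rw [Finset.sum_range_succ']
    simp only [tabooP_add_two]
    have e1 : ∑ d ∈ D, tabooP p B (0 + 1) i d = ∑' r, if r ∈ D then p i r else 0 := by
      rw [tsum_eq_sum (s := D) fun r hr => by simp [hr]]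
      exact Finset.sum_congr rfl fun r hr => by simp [hr, tabooP]
    have hsD : ∀ k, Summable fun r => ∑ d ∈ D,
        Bᶜ.indicator (fun r => p i r * tabooP p B (k + 1) r d) r :=
      fun k => summable_sum fun d _ => hs k d
    simp_rw [← Summable.tsum_finsetSum fun d _ => hs _ d]
    rw [← Summable.tsum_finsetSum fun k _ => hsD k, e1,
      ← Summable.tsum_add (summable_sum fun k _ => hsD k) hpD, ← (hrow i).tsum_eq]
    refine Summable.tsum_le_tsum (fun r => ?_) ((summable_sum fun k _ => hsD k).add hpD)
      (hrow i).summable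
    by_cases hrB : r ∈ B
    · simp only [Set.indicator, Set.mem_compl_iff, hrB, not_true, if_false, Finset.sum_const_zero,
        zero_add]
      split_ifs
      exacts [le_rfl, hp i r]
    · have hrD : r ∉ D := fun h => hrB (hD h)
      simp only [Set.indicator, Set.mem_compl_iff, hrB, not_false_eq_true, if_true, hrD, if_false,
        add_zero, ← Finset.mul_sum]
      exact mul_le_of_le_one_right (hp i r) (ih r)

theorem nstep_nonneg (hp : ∀ i j, 0 ≤ p i j) (n : ℕ) (i j : S) : 0 ≤ nstep p n i j :=
  tabooP_nonneg hp ∅ n i j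

theorem nstep_le_one (hp : ∀ i j, 0 ≤ p i j) (hrow : ∀ i, HasSum (fun j => p i j) 1)
    (n : ℕ) (i j : S) : nstep p n i j ≤ 1 :=
  tabooP_le_one hp hrow ∅ n i j

theorem sum_nstep_le_one (hp : ∀ i j, 0 ≤ p i j)
    (hrow : ∀ i, HasSum (fun j => p i j) 1) (D : Finset S) (n : ℕ) :
    ∀ i, ∑ d ∈ D, nstep p (n + 1) i d ≤ 1 := by
  induction n with
  | zero =>
    intro i
    rw [← (hrow i).tsum_eq]
    exact (hrow i).summable.sum_le_tsum D fun d _ => hp i d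
  | succ n ih =>
    intro i
    have hs := fun d => summable_indicator_mul_tabooP hp hrow ∅ᶜ ∅ (n + 1) i d
    simp only [nstep, tabooP_add_two] at ih ⊢
    rw [← Summable.tsum_finsetSum fun d _ => hs d, ← (hrow i).tsum_eq]
    refine (summable_sum fun d _ => hs d).tsum_le_tsum (fun r => ?_) (hrow i).summable
    simp only [Set.indicator, Set.mem_compl_iff, Set.mem_empty_iff_false, not_false_eq_true,
      if_true, ← Finset.mul_sum]
    exact mul_le_of_le_one_right (hp i r) (ih r)

/-- Integrating a bounded function against a stationary distribution after one step. -/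
theorem hasSum_mul_tsum_mul (hp : ∀ i j, 0 ≤ p i j) (hrow : ∀ i, HasSum (fun j => p i j) 1)
    {π : S → ℝ} (hπ : ∀ j, 0 ≤ π j) (hπs : Summable π)
    (hstat : ∀ j, HasSum (fun i => π i * p i j) (π j)) {g : S → ℝ} (hg0 : ∀ r, 0 ≤ g r)
    (hg1 : ∀ r, g r ≤ 1) {s : ℝ} (hg : HasSum (fun r => π r * g r) s) :
    HasSum (fun i => π i * ∑' r, p i r * g r) s := by
  have hs : ∀ i, Summable fun r => p i r * g r := fun i =>
    summable_mul_of_bounded hp hrow hg0 hg1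
  have hsum : Summable fun i => ∑' r, π i * (p i r * g r) := by
    refine Summable.of_nonneg_of_le
      (fun i => tsum_nonneg fun r => mul_nonneg (hπ i) (mul_nonneg (hp i r) (hg0 r)))
      (fun i => ?_) hπs
    rw [tsum_mul_left]
    refine mul_le_of_le_one_right (hπ i) ?_
    rw [← (hrow i).tsum_eq]
    exact (hs i).tsum_le_tsum (fun r => mul_le_of_le_one_right (hp i r) (hg1 r)) (hrow i).summable
  have hprod : Summable fun x : S × S => π x.1 * (p x.1 x.2 * g x.2) :=
    (summable_prod_of_nonneg fun x =>
      mul_nonneg (hπ x.1) (mul_nonneg (hp x.1 x.2) (hg0 x.2))).2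
      ⟨fun i => (hs i).mul_left (π i), hsum⟩
  have hcol : ∀ r, HasSum (fun i => π i * (p i r * g r)) (π r * g r) := fun r => by
    simpa only [mul_assoc] using (hstat r).mul_right (g r)
  simp_rw [← tsum_mul_left]
  rw [hsum.hasSum_iff, ← Summable.tsum_comm' (f := fun i r => π i * (p i r * g r)) hprod
    (fun i => (hs i).mul_left (π i)) fun r => (hcol r).summable]
  simp_rw [(hcol _).tsum_eq]
  exact hg.tsum_eq

theorem hasSum_mul_nstep (hp : ∀ i j, 0 ≤ p i j) (hrow : ∀ i, HasSum (fun j => p i j) 1)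
    {π : S → ℝ} (hπ : ∀ j, 0 ≤ π j) (hπs : Summable π)
    (hstat : ∀ j, HasSum (fun i => π i * p i j) (π j)) (n : ℕ) (j : S) :
    HasSum (fun i => π i * nstep p (n + 1) i j) (π j) := by
  induction n with
  | zero => exact hstat j
  | succ n ih =>
    have h := hasSum_mul_tsum_mul hp hrow hπ hπs hstat
      (fun r => nstep_nonneg hp (n + 1) r j) (fun r => nstep_le_one hp hrow (n + 1) r j) ih
    simpa [nstep, tabooP_add_two] using h

theorem stationary_eq_tsum_of_tendsto (hp : ∀ i j, 0 ≤ p i j)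
    (hrow : ∀ i, HasSum (fun j => p i j) 1) {π : S → ℝ} (hπ : ∀ j, 0 ≤ π j) (hπs : Summable π)
    (hstat : ∀ j, HasSum (fun i => π i * p i j) (π j)) {j : S} {l : S → ℝ}
    (hl : ∀ i, Filter.Tendsto (fun n => nstep p (n + 1) i j) Filter.atTop (nhds (l i))) :
    π j = ∑' i, π i * l i := by
  have h := tendsto_tsum_of_dominated_convergence (𝓕 := Filter.atTop)
    (f := fun n i => π i * nstep p (n + 1) i j) hπs (fun i => (hl i).const_mul (π i))
    (Filter.Eventually.of_forall fun n i => by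
      rw [Real.norm_of_nonneg (mul_nonneg (hπ i) (nstep_nonneg hp _ _ _))]
      exact mul_le_of_le_one_right (hπ i) (nstep_le_one hp hrow _ _ _))
  simp only [(hasSum_mul_nstep hp hrow hπ hπs hstat _ j).tsum_eq] at h
  exact tendsto_nhds_unique tendsto_const_nhds h

theorem stationary_pos (hp : ∀ i j, 0 ≤ p i j) (hrow : ∀ i, HasSum (fun j => p i j) 1)
    (hirr : ∀ i j, ∃ n, 1 ≤ n ∧ 0 < nstep p n i j)
    {π : S → ℝ} (hπ : ∀ j, 0 ≤ π j) (hπ1 : HasSum π 1)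
    (hstat : ∀ j, HasSum (fun i => π i * p i j) (π j)) (j : S) : 0 < π j := by
  obtain ⟨i, hi⟩ : ∃ i, 0 < π i := by
    by_contra! h
    have : π = 0 := funext fun i => le_antisymm (h i) (hπ i)
    rw [this] at hπ1
    exact one_ne_zero (hπ1.unique hasSum_zero)
  obtain ⟨n, hn, hpos⟩ := hirr i j
  obtain ⟨n, rfl⟩ := Nat.exists_eq_add_of_le' hn
  have hs := hasSum_mul_nstep hp hrow hπ hπ1.summable hstat n j
  exact (mul_pos hi hpos).trans_le (le_hasSum hs i fun k _ =>
    mul_nonneg (hπ k) (nstep_nonneg hp _ _ _))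

theorem sum_coeff_tabooGF_le_one (hp : ∀ i j, 0 ≤ p i j)
    (hrow : ∀ i, HasSum (fun j => p i j) 1) {D : Finset S} (hD : ↑D ⊆ B) (i : S) (N : ℕ) :
    ∑ n ∈ Finset.range N, ∑ d ∈ D, coeff n (tabooGF p B i d) ≤ 1 := by
  cases N with
  | zero => simp
  | succ N =>
    rw [Finset.sum_range_succ']
    simpa [coeff_tabooGF] using sum_tabooP_le_one hp hrow hD N i

theorem tsum_coeff_tabooGF_le_one (hp : ∀ i j, 0 ≤ p i j)
    (hrow : ∀ i, HasSum (fun j => p i j) 1) {c : S} (hc : c ∈ B) (i : S) :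
    ∑' n, coeff n (tabooGF p B i c) ≤ 1 := by
  refine Real.tsum_le_of_sum_range_le (fun n => coeff_tabooGF_nonneg hp n i c) fun N => ?_
  simpa using sum_coeff_tabooGF_le_one hp hrow (D := {c}) (by simpa using hc) i N

theorem one_add_tabooGF_eq (hp : ∀ i j, 0 ≤ p i j)
    (hrow : ∀ i, HasSum (fun j => p i j) 1) {A : Set S} {c : S} (hc : c ∉ A) :
    1 + tabooGF p A c c = 1 + tabooGF p (insert c A) c c * (1 + tabooGF p A c c) := by
  linear_combination tabooGF_eq_add_mul hp hrow hc c c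

theorem tabooGF_eq_add_mul_mul (hp : ∀ i j, 0 ≤ p i j)
    (hrow : ∀ i, HasSum (fun j => p i j) 1) {A : Set S} {c : S} (hc : c ∉ A) (i j : S) :
    tabooGF p A i j = tabooGF p (insert c A) i j +
      tabooGF p (insert c A) i c * ((1 + tabooGF p A c c) * tabooGF p (insert c A) c j) := by
  have h1 := tabooGF_eq_add_mul hp hrow hc i j
  have h2 := tabooGF_eq_add_mul hp hrow hc c j
  have h3 := one_add_tabooGF_eq hp hrow hc
  have h4 : tabooGF p A c j = (1 + tabooGF p A c c) * tabooGF p (insert c A) c j := by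
    linear_combination (1 + tabooGF p A c c) * h2 - tabooGF p A c j * h3
  rw [← h4, ← h1]

theorem exists_wSummable_tabooGF_of_tsum_lt_one (hp : ∀ i j, 0 ≤ p i j)
    (hrow : ∀ i, HasSum (fun j => p i j) 1) {A : Set S} {c : S} (hc : c ∉ A) {R : ℝ} (hR : 1 < R)
    (hW : ∀ i j, WSummable R (tabooGF p (insert c A) i j))
    (hlt : ∑' n, coeff n (tabooGF p (insert c A) c c) < 1) :
    ∃ r, 1 < r ∧ ∀ i j, WSummable r (tabooGF p A i j) := by
  obtain ⟨r, hr1, hrR, hu⟩ := exists_wSummable_inverse_of_tsum_lt_one hR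
    (fun n => coeff_tabooGF_nonneg hp n c c)
    (fun n => by
      rw [map_add]
      refine add_nonneg ?_ (coeff_tabooGF_nonneg hp n c c)
      rw [coeff_one]
      split_ifs <;> simp) (hW c c) hlt (one_add_tabooGF_eq hp hrow hc)
  have hr0 : 0 ≤ r := by linarith
  refine ⟨r, hr1, fun i j => ?_⟩
  rw [tabooGF_eq_add_mul_mul hp hrow hc]
  exact ((hW i j).mono hr0 hrR).add hr0
    (((hW i c).mono hr0 hrR).mul hr0 (hu.mul hr0 ((hW c j).mono hr0 hrR)))

theorem tabooGF_empty_eq_zero (hp : ∀ i j, 0 ≤ p i j)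
    (hrow : ∀ i, HasSum (fun j => p i j) 1) {A : Set S} (hA : A.Finite) {D : Set S} {c : S}
    (hAD : A ⊆ D) (h : ∀ d ∈ D, tabooGF p A c d = 0) {d : S} (hd : d ∈ D) :
    tabooGF p ∅ c d = 0 := by
  induction A, hA using Set.Finite.induction_on with
  | empty => exact h d hd
  | @insert a A ha hA ih =>
    refine ih ((Set.subset_insert a A).trans hAD) fun d hd => ?_
    rw [tabooGF_eq_add_mul hp hrow ha, h d hd, h a (hAD (Set.mem_insert a A))]
    simp

/-- From a state `c` of an irreducible chain, the other points of a finite set `insert c A` are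
hit with positive probability before returning to `c`. -/
theorem tsum_coeff_tabooGF_lt_one (hp : ∀ i j, 0 ≤ p i j)
    (hrow : ∀ i, HasSum (fun j => p i j) 1) (hirr : ∀ i j, ∃ n, 1 ≤ n ∧ 0 < nstep p n i j)
    {A : Set S} (hA : A.Finite) (hne : A.Nonempty) {c : S} (hc : c ∉ A)
    (hs : ∀ j, Summable fun n => coeff n (tabooGF p (insert c A) c j)) :
    ∑' n, coeff n (tabooGF p (insert c A) c c) < 1 := by
  obtain ⟨b, hb, m, hm⟩ : ∃ b ∈ A, ∃ m, 0 < coeff m (tabooGF p (insert c A) c b) := by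
    by_contra! h
    obtain ⟨a, ha⟩ := hne
    have hz : ∀ d ∈ A, tabooGF p A c d = 0 := fun d hd => by
      rw [tabooGF_eq_add_mul_mul hp hrow hc,
        show tabooGF p (insert c A) c d = 0 from
          PowerSeries.ext fun n => le_antisymm (h d hd n) (coeff_tabooGF_nonneg hp n c d)]
      simp
    have h0 := tabooGF_empty_eq_zero hp hrow hA subset_rfl hz ha
    obtain ⟨n, hn, hpos⟩ := hirr c a
    have := coeff_tabooGF (p := p) (B := ∅) (n := n) (by lia) c a
    rw [h0, map_zero] at this
    exact hpos.ne this
  have hcb : c ≠ b := fun h => hc (h ▸ hb)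
  have hle : ∑' n, (coeff n (tabooGF p (insert c A) c c)
      + coeff n (tabooGF p (insert c A) c b)) ≤ 1 := by
    refine Real.tsum_le_of_sum_range_le (fun n =>
      add_nonneg (coeff_tabooGF_nonneg hp n c c) (coeff_tabooGF_nonneg hp n c b)) fun N => ?_
    have hsub : ((({c, b} : Finset S)) : Set S) ⊆ insert c A := by
      intro x hx
      simp only [Finset.coe_insert, Finset.coe_singleton, Set.mem_insert_iff,
        Set.mem_singleton_iff] at hx
      rcases hx with rfl | rfl
      · exact Set.mem_insert _ _
      · exact Set.mem_insert_of_mem _ hb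
    simpa [Finset.sum_pair hcb] using sum_coeff_tabooGF_le_one hp hrow hsub c N
  rw [(hs c).tsum_add (hs b)] at hle
  have := (hs b).tsum_pos (fun n => coeff_tabooGF_nonneg hp n c b) m hm
  linarith

theorem WSummable.summable_coeff {R : ℝ} {a : PowerSeries ℝ} (ha : WSummable R a) (hR : 1 ≤ R) :
    Summable fun n => coeff n a := by
  have h := ha.mono zero_le_one hR
  simpa only [WSummable, one_pow, mul_one, summable_abs_iff] using h

/-- A finite nonempty taboo set with geometric decay can be reduced to a single point. -/
theorem exists_singleton_wSummable_tabooGF (hp : ∀ i j, 0 ≤ p i j)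
    (hrow : ∀ i, HasSum (fun j => p i j) 1) (hirr : ∀ i j, ∃ n, 1 ≤ n ∧ 0 < nstep p n i j)
    (hB : B.Finite) (hne : B.Nonempty)
    (hW : ∃ R, 1 < R ∧ ∀ i j, WSummable R (tabooGF p B i j)) :
    ∃ c R, 1 < R ∧ ∀ i j, WSummable R (tabooGF p {c} i j) := by
  induction B, hB using Set.Finite.induction_on with
  | empty => exact absurd hne (by simp)
  | @insert c A hc hA ih =>
    rcases A.eq_empty_or_nonempty with rfl | hAne
    · exact ⟨c, by simpa using hW⟩
    · obtain ⟨R, hR, hW⟩ := hW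
      exact ih hAne (exists_wSummable_tabooGF_of_tsum_lt_one hp hrow hc hR hW
        (tsum_coeff_tabooGF_lt_one hp hrow hirr hA hAne hc fun j =>
          (hW c j).summable_coeff hR.le))

theorem WSummable.abs_tsum_coeff_nat_add_le {r : ℝ} (hr : 1 < r) {d : PowerSeries ℝ}
    (hd : WSummable r d) (n : ℕ) :
    |∑' k, coeff (k + (n + 1)) d| ≤ (∑' k, |coeff k d| * r ^ k) * r⁻¹ ^ n := by
  have hr0 : 0 < r := by linarith
  have htail : Summable fun k => |coeff (k + (n + 1)) d| * r ^ (k + (n + 1)) :=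
    (summable_nat_add_iff (f := fun k => |coeff k d| * r ^ k) (n + 1)).2 hd
  have hbound : ∀ k, ‖coeff (k + (n + 1)) d‖ ≤
      (|coeff (k + (n + 1)) d| * r ^ (k + (n + 1))) * r⁻¹ ^ n := by
    intro k
    have h1 : r ^ (k + (n + 1)) * r⁻¹ ^ n = r ^ (k + 1) := by
      rw [inv_pow, show k + (n + 1) = (k + 1) + n by ring, pow_add r (k + 1) n,
        mul_inv_cancel_right₀ (by positivity)]
    rw [mul_assoc, h1, Real.norm_eq_abs]
    exact le_mul_of_one_le_right (abs_nonneg _) (one_le_pow₀ hr.le)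
  refine (tsum_of_norm_bounded (htail.mul_right (r⁻¹ ^ n)).hasSum hbound).trans ?_
  rw [tsum_mul_right]
  refine mul_le_mul_of_nonneg_right ?_ (by positivity)
  rw [← Summable.sum_add_tsum_nat_add (f := fun k => |coeff k d| * r ^ k) (n + 1) hd]
  exact le_add_of_nonneg_left (Finset.sum_nonneg fun k _ => by positivity)

theorem coeff_eq_sum_range_coeff_one_sub_X_mul (a : PowerSeries ℝ) (n : ℕ) :
    coeff n a = ∑ k ∈ Finset.range (n + 1), coeff k ((1 - X) * a) := by
  induction n with
  | zero => simp [sub_mul]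
  | succ n ih =>
    rw [Finset.sum_range_succ, ← ih, sub_mul, one_mul, map_sub, coeff_succ_X_mul]
    ring

theorem WSummable.abs_coeff_sub_tsum_le {r : ℝ} (hr : 1 < r) {a : PowerSeries ℝ}
    (ha : WSummable r ((1 - X) * a)) (n : ℕ) :
    |coeff n a - ∑' k, coeff k ((1 - X) * a)| ≤
      (∑' k, |coeff k ((1 - X) * a)| * r ^ k) * r⁻¹ ^ n := by
  rw [coeff_eq_sum_range_coeff_one_sub_X_mul a n,
    ← (ha.summable_coeff hr.le).sum_add_tsum_nat_add (n + 1), sub_add_cancel_left, abs_neg]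
  exact ha.abs_tsum_coeff_nat_add_le hr n

theorem WSummable.tendsto_coeff {r : ℝ} (hr : 1 < r) {a : PowerSeries ℝ}
    (ha : WSummable r ((1 - X) * a)) :
    Filter.Tendsto (fun n => coeff n a) Filter.atTop (nhds (∑' k, coeff k ((1 - X) * a))) := by
  rw [tendsto_iff_norm_sub_tendsto_zero]
  refine squeeze_zero (fun n => norm_nonneg _) (fun n => ha.abs_coeff_sub_tsum_le hr n) ?_
  simpa using (tendsto_pow_atTop_nhds_zero_of_lt_one (inv_nonneg.2 (by linarith))
    (inv_lt_one_of_one_lt₀ hr)).const_mul _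

theorem tsum_coeff_one_sub_X : ∑' k, coeff k (1 - X : PowerSeries ℝ) = 0 := by
  rw [tsum_eq_sum (s := Finset.range 2) fun n hn => ?_]
  · simp [coeff_one, coeff_X]
  · simp only [Finset.mem_range] at hn
    rw [map_sub, coeff_one, coeff_X, if_neg (by lia), if_neg (by lia), sub_zero]

theorem tendsto_nstep_of_tendsto_coeff {i j : S} {l : ℝ}
    (h : Filter.Tendsto (fun n => coeff n (tabooGF p ∅ i j)) Filter.atTop (nhds l)) :
    Filter.Tendsto (fun n => nstep p (n + 1) i j) Filter.atTop (nhds l) := by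
  refine (h.comp (Filter.tendsto_add_atTop_nat 1)).congr fun n => ?_
  simp [coeff_tabooGF, nstep]

/-- A chain with a stationary distribution returns to `c` almost surely. -/
theorem hasSum_coeff_tabooGF_singleton (hp : ∀ i j, 0 ≤ p i j)
    (hrow : ∀ i, HasSum (fun j => p i j) 1) {π : S → ℝ} (hπ : ∀ j, 0 ≤ π j) (hπ1 : HasSum π 1)
    (hstat : ∀ j, HasSum (fun i => π i * p i j) (π j)) {c : S} {R : ℝ} (hR : 1 < R)
    (hW : ∀ i j, WSummable R (tabooGF p {c} i j)) :
    HasSum (fun n => coeff n (tabooGF p {c} c c)) 1 := by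
  rw [((hW c c).summable_coeff hR.le).hasSum_iff]
  refine (tsum_coeff_tabooGF_le_one hp hrow (Set.mem_singleton c) c).antisymm (le_of_not_gt fun hlt => ?_)
  have e : insert c (∅ : Set S) = {c} := by simp
  obtain ⟨r, hr, hW0⟩ := exists_wSummable_tabooGF_of_tsum_lt_one hp hrow
    (Set.notMem_empty c) hR (by rwa [e]) (by rwa [e])
  have hzero : ∀ j, π j = 0 := fun j => by
    rw [stationary_eq_tsum_of_tendsto hp hrow hπ hπ1.summable hstat (l := 0) fun i =>
      tendsto_nstep_of_tendsto_coeff ((hW0 i j).summable_coeff hr.le).tendsto_atTop_zero]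
    simp
  rw [funext hzero] at hπ1
  exact one_ne_zero (hπ1.unique hasSum_zero)

/-- The first-return times of an aperiodic state have greatest common divisor one. -/
theorem eq_one_of_forall_dvd_of_coeff_pos (hp : ∀ i j, 0 ≤ p i j)
    (hrow : ∀ i, HasSum (fun j => p i j) 1) {c : S}
    (haper : ∀ d : ℕ, (∀ n, 1 ≤ n → 0 < nstep p n c c → d ∣ n) → d = 1) {d : ℕ}
    (hd : ∀ n, 0 < coeff n (tabooGF p {c} c c) → d ∣ n) : d = 1 := by
  refine haper d fun n => ?_
  induction n using Nat.strong_induction_on with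
  | _ n ih =>
    intro hn hpos
    have h := congrArg (coeff n) (tabooGF_eq_add_mul hp hrow (Set.notMem_empty c) c c)
    rw [coeff_tabooGF (by lia), map_add, coeff_mul, insert_empty_eq] at h
    by_contra hnd
    have h1 : coeff n (tabooGF p {c} c c) = 0 :=
      le_antisymm (not_lt.1 fun h => hnd (hd n h)) (coeff_tabooGF_nonneg hp n c c)
    rw [h1, zero_add, Finset.sum_eq_zero] at h
    · exact hpos.ne' h
    · rintro ⟨k, m⟩ hkm
      rw [Finset.HasAntidiagonal.mem_antidiagonal] at hkm
      dsimp only at hkm ⊢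
      by_contra hne
      obtain ⟨hk, hm⟩ := mul_ne_zero_iff.1 hne
      have hk0 : k ≠ 0 := by rintro rfl; simp at hk
      have hm0 : m ≠ 0 := by rintro rfl; simp at hm
      have hdk := hd k ((coeff_tabooGF_nonneg hp k c c).lt_of_ne' hk)
      have hdm := ih m (by lia) (by lia) (by
        have := (coeff_tabooGF_nonneg hp m c c).lt_of_ne' hm
        rwa [coeff_tabooGF hm0] at this)
      exact hnd (hkm ▸ dvd_add hdk hdm)

theorem exists_wSummable_tabooGF_of_le (hp : ∀ i j, 0 ≤ p i j) {τ : ℝ} (hτ0 : 0 < τ)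
    (hτ1 : τ < 1) {C : S → S → ℝ} (hC : ∀ i j, 0 < C i j)
    (hdecay : ∀ i j : S, ∀ n : ℕ, 1 ≤ n → tabooP p B n i j ≤ C i j * τ ^ n) :
    ∃ R, 1 < R ∧ ∀ i j, WSummable R (tabooGF p B i j) := by
  obtain ⟨s, hs1, hs2⟩ := exists_between hτ1
  have hs0 : 0 < s := hτ0.trans hs1
  refine ⟨s / τ, (one_lt_div hτ0).2 hs1, fun i j => ?_⟩
  refine Summable.of_nonneg_of_le (fun n => by positivity) (fun n => ?_)
    ((summable_geometric_of_lt_one hs0.le hs2).mul_left (C i j))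
  rcases Nat.eq_zero_or_pos n with rfl | hn
  · simpa using (hC i j).le
  · rw [abs_of_nonneg (coeff_tabooGF_nonneg hp n i j), coeff_tabooGF hn.ne']
    calc _ ≤ C i j * τ ^ n * (s / τ) ^ n := by
          gcongr
          exact hdecay i j n hn
      _ = C i j * s ^ n := by
          rw [mul_assoc, ← mul_pow, mul_div_cancel₀ _ hτ0.ne']

/-- If the `n`-step transition probabilities converge to limits of product form `h i * m j` with
`h ≤ 1`, then the limits agree with the stationary distribution. -/
theorem limit_eq_stationary (hp : ∀ i j, 0 ≤ p i j)
    (hrow : ∀ i, HasSum (fun j => p i j) 1) (hirr : ∀ i j, ∃ n, 1 ≤ n ∧ 0 < nstep p n i j)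
    {π : S → ℝ} (hπ : ∀ j, 0 ≤ π j) (hπ1 : HasSum π 1)
    (hstat : ∀ j, HasSum (fun i => π i * p i j) (π j)) {h m : S → ℝ} {c : S} (hc : h c = 1)
    (h0 : ∀ i, 0 ≤ h i) (h1 : ∀ i, h i ≤ 1)
    (hlim : ∀ i j, Filter.Tendsto (fun n => nstep p (n + 1) i j) Filter.atTop
      (nhds (h i * m j))) (i j : S) : h i * m j = π j := by
  set κ := ∑' i, π i * h i with hκ
  have hsκ : Summable fun i => π i * h i := Summable.of_nonneg_of_le
    (fun i => mul_nonneg (hπ i) (h0 i)) (fun i => mul_le_of_le_one_right (hπ i) (h1 i))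
    hπ1.summable
  have hπκ : ∀ j, π j = κ * m j := fun j => by
    rw [stationary_eq_tsum_of_tendsto hp hrow hπ hπ1.summable hstat fun i => hlim i j, hκ,
      ← tsum_mul_right]
    exact tsum_congr fun i => by ring
  have hm : ∀ D : Finset S, ∑ d ∈ D, m d ≤ 1 := fun D => by
    have := tendsto_finsetSum D fun d _ => hlim c d
    simp only [hc, one_mul] at this
    exact le_of_tendsto' this fun n => sum_nstep_le_one hp hrow D n c
  have hκ0 : 0 ≤ κ := tsum_nonneg fun i => mul_nonneg (hπ i) (h0 i)
  have hκ1 : 1 ≤ κ := by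
    refine hasSum_le_of_sum_le hπ1 fun D => ?_
    simp_rw [hπκ, ← Finset.mul_sum]
    exact mul_le_of_le_one_right hκ0 (hm D)
  have hdiff : HasSum (fun i => π i * (1 - h i)) (1 - κ) := by
    simpa [mul_sub] using hπ1.sub hsκ.hasSum
  have hnn : ∀ i, 0 ≤ π i * (1 - h i) := fun i => mul_nonneg (hπ i) (sub_nonneg.2 (h1 i))
  have hκe : κ = 1 := le_antisymm (by linarith [hdiff.nonneg hnn]) hκ1
  rw [hκe, sub_self, hasSum_zero_iff_of_nonneg hnn] at hdiff
  have hi := congrFun hdiff i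
  have hpos := stationary_pos hp hrow hirr hπ hπ1 hstat i
  simp only [Pi.zero_apply, mul_eq_zero, hpos.ne', false_or] at hi
  rw [hπκ j, hκe, show h i = 1 by linarith]

end Taboo

/-- Proposition 4.4: if the taboo probabilities with a nonempty finite taboo set `B` decay
exponentially, then an irreducible aperiodic chain with stationary distribution `π`
converges to `π` exponentially fast. -/
theorem stmt_6 {S : Type*} [Countable S] (p : S → S → ℝ)
    (hp_nonneg : ∀ i j, 0 ≤ p i j)
    (hp_row : ∀ i, HasSum (fun j => p i j) 1)
    (hirr : ∀ i j, ∃ n, 1 ≤ n ∧ 0 < nstep p n i j)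
    (haper : ∀ i, ∀ d : ℕ, (∀ n, 1 ≤ n → 0 < nstep p n i i → d ∣ n) → d = 1)
    (π : S → ℝ) (hπ_nonneg : ∀ j, 0 ≤ π j) (hπ_sum : HasSum π 1)
    (hπ_stat : ∀ j, HasSum (fun i => π i * p i j) (π j))
    (B : Set S) (hBfin : B.Finite) (hBne : B.Nonempty)
    (τ : ℝ) (hτ0 : 0 < τ) (hτ1 : τ < 1)
    (C : S → S → ℝ) (hC : ∀ i j, 0 < C i j)
    (hdecay : ∀ i j : S, ∀ n : ℕ, 1 ≤ n → tabooP p B n i j ≤ C i j * τ ^ n) :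
    ∃ θhat : ℝ, 0 < θhat ∧ θhat < 1 ∧ ∃ Chat : S → S → ℝ, (∀ i j, 0 < Chat i j) ∧
      ∀ i j : S, ∀ n : ℕ, 1 ≤ n → |nstep p n i j - π j| ≤ Chat i j * θhat ^ n := by
  obtain ⟨c, R, hR, hW⟩ := exists_singleton_wSummable_tabooGF hp_nonneg hp_row hirr hBfin hBne
    (exists_wSummable_tabooGF_of_le hp_nonneg hτ0 hτ1 hC hdecay)
  have hrec := hasSum_coeff_tabooGF_singleton hp_nonneg hp_row hπ_nonneg hπ_sum hπ_stat hR hW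
  have hren := one_add_tabooGF_eq hp_nonneg hp_row (Set.notMem_empty c)
  rw [insert_empty_eq] at hren
  obtain ⟨r, hr1, hrR, hv⟩ := exists_wSummable_one_sub_X_mul_renewal hR (hW c c)
    (fun n => coeff_tabooGF_nonneg hp_nonneg n c c) (coeff_zero_tabooGF c c) hrec
    (fun d hd => eq_one_of_forall_dvd_of_coeff_pos hp_nonneg hp_row (haper c) hd)
    (fun n => by
      rcases Nat.eq_zero_or_pos n with rfl | hn
      · rw [map_add, coeff_zero_tabooGF]
        simp
      · rw [map_add, PowerSeries.coeff_one, if_neg hn.ne', zero_add, coeff_tabooGF hn.ne',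
          abs_of_nonneg (tabooP_nonneg hp_nonneg ∅ n c c)]
        exact tabooP_le_one hp_nonneg hp_row ∅ n c c) hren
  have hr0 : 0 ≤ r := by linarith
  have hWr : ∀ i j, WSummable r (tabooGF p {c} i j) := fun i j => (hW i j).mono hr0 hrR
  set v := (1 - PowerSeries.X) * (1 + tabooGF p ∅ c c) with hv_def
  have hd : ∀ i j, (1 - PowerSeries.X) * tabooGF p ∅ i j =
      (1 - PowerSeries.X) * tabooGF p {c} i j +
        tabooGF p {c} i c * (v * tabooGF p {c} c j) := fun i j => by
    have h := tabooGF_eq_add_mul_mul hp_nonneg hp_row (Set.notMem_empty c) i j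
    rw [insert_empty_eq] at h
    rw [h]
    ring
  have hd1 : ∀ i j, WSummable r ((1 - PowerSeries.X) * tabooGF p {c} i j) := fun i j =>
    wSummable_one_sub_X.mul hr0 (hWr i j)
  have hd2 : ∀ j, WSummable r (v * tabooGF p {c} c j) := fun j => hv.mul hr0 (hWr c j)
  have hdW : ∀ i j, WSummable r ((1 - PowerSeries.X) * tabooGF p ∅ i j) := fun i j => by
    rw [hd]
    exact (hd1 i j).add hr0 ((hWr i c).mul hr0 (hd2 j))
  have hdS : ∀ i j, ∑' k, PowerSeries.coeff k ((1 - PowerSeries.X) * tabooGF p ∅ i j) =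
      (∑' k, PowerSeries.coeff k (tabooGF p {c} i c)) *
        ∑' k, PowerSeries.coeff k (v * tabooGF p {c} c j) := fun i j => by
    simp only [hd, map_add]
    rw [((hd1 i j).summable_coeff hr1.le).tsum_add
      (((hWr i c).mul hr0 (hd2 j)).summable_coeff hr1.le),
      wSummable_one_sub_X.tsum_coeff_mul ((hWr i j).mono zero_le_one hr1.le),
      ((hWr i c).mono zero_le_one hr1.le).tsum_coeff_mul ((hd2 j).mono zero_le_one hr1.le),
      tsum_coeff_one_sub_X, zero_mul, zero_add]
  have hlim := limit_eq_stationary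
    (m := fun j => ∑' k, PowerSeries.coeff k (v * tabooGF p {c} c j)) hp_nonneg hp_row hirr hπ_nonneg hπ_sum hπ_stat hrec.tsum_eq
    (fun i => tsum_nonneg fun k => coeff_tabooGF_nonneg hp_nonneg k i c)
    (fun i => tsum_coeff_tabooGF_le_one hp_nonneg hp_row (Set.mem_singleton c) i) fun i j =>
      hdS i j ▸ tendsto_nstep_of_tendsto_coeff ((hdW i j).tendsto_coeff hr1)
  refine ⟨r⁻¹, inv_pos.2 (by linarith), inv_lt_one_of_one_lt₀ hr1, fun i j =>
    (∑' k, |PowerSeries.coeff k ((1 - PowerSeries.X) * tabooGF p ∅ i j)| * r ^ k) + 1,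
    fun i j => by positivity, fun i j n hn => ?_⟩
  have h := (hdW i j).abs_coeff_sub_tsum_le hr1 n
  rw [hdS, hlim, coeff_tabooGF (by lia)] at h
  refine h.trans ?_
  gcongr
  exact le_add_of_nonneg_right zero_le_one
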